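/- Let p be the hidden Markov model measure associated with f_0, (f_t), (g_t) on standard Borel spaces. Fix 0 ≤ t ≤ n. Let B_t := (p^{Y_{[t]}, X_t}).condKernel be the Bayes filter, where p^{Y_{[t]}, X_t} is the marginal of p on (∏_{i=0}^t Y_i) × X_t, and let ξ_t := (p^{Y_{[n]}, X_t}).condKernel be the Bayes smoother, where p^{Y_{[n]}, X_t} is the marginal of p on (∏_{i=0}^n Y_i) × X_t. Let β_t be the Markov kernel from X_t to ∏_{i=t+1}^n Y_i sending x to the law of the future observations generated from X_t = x by iterating the kernels f_{t+1}, g_{t+1}, …, f_n, g_n and forgetting the hidden states. Define the Markov kernel κ from ∏_{i=0}^t Y_i to (∏_{i=t+1}^n Y_i) × X_t by κ(y) := the pushforward under Prod.swap of the composition-product (B_t y) ⊗ₘ β_t. Then, identifying ∏_{i=0}^n Y_i with (∏_{i=0}^t Y_i) × (∏_{i=t+1}^n Y_i), the Bayes smoother satisfies ξ_t = Kernel.condKernel κ almost everywhere with respect to the Y-marginal p^{Y_{[n]}} of p; that is, smoothing can be performed by conditioning the filter output on the future observations. -/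

import Mathlib

open MeasureTheory ProbabilityTheory
open scoped ENNReal

namespace BorelHMM

variable {n : ℕ}

section HMMDef

variable {X Y : Fin (n+1) → Type*} [∀ i, MeasurableSpace (X i)] [∀ i, MeasurableSpace (Y i)]

/-- Backward value function computing the iterated integral defining the hidden Markov
model measure on rectangles. -/
noncomputable def hmmBack (f : ∀ t : Fin n, Kernel (X t.castSucc) (X t.succ))
    (g : ∀ t : Fin (n+1), Kernel (X t) (Y t))
    (S : ∀ i, Set (X i)) (T : ∀ i, Set (Y i)) : ∀ t : Fin (n+1), X t → ℝ≥0∞ :=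
  Fin.reverseInduction (fun x => g (Fin.last n) x (T (Fin.last n)))
    (fun i ih x => g i.castSucc x (T i.castSucc) * ∫⁻ x' in S i.succ, ih x' ∂ (f i x))

/-- `p` is the hidden Markov model measure associated with the initial distribution `f₀`,
the transition kernels `f` and the observation kernels `g`. -/
def IsHMM (p : Measure (∀ i, X i × Y i))
    (f₀ : Measure (X 0)) (f : ∀ t : Fin n, Kernel (X t.castSucc) (X t.succ))
    (g : ∀ t : Fin (n+1), Kernel (X t) (Y t)) : Prop :=
  ∀ (S : ∀ i, Set (X i)) (T : ∀ i, Set (Y i)),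
    (∀ i, MeasurableSet (S i)) → (∀ i, MeasurableSet (T i)) →
      p (Set.univ.pi fun i => (S i) ×ˢ (T i)) = ∫⁻ x₀ in S 0, hmmBack f g S T 0 x₀ ∂ f₀

end HMMDef

/-- The inclusion `Fin (t+1) → Fin (n+1)` for `t ≤ n`. -/
def emb {t : ℕ} (ht : t ≤ n) (i : Fin (t+1)) : Fin (n+1) :=
  ⟨i.1, Nat.lt_succ_of_le (le_trans (Nat.le_of_lt_succ i.isLt) ht)⟩

/-- The element `t : Fin (n+1)` for `t ≤ n`. -/
def idx {t : ℕ} (ht : t ≤ n) : Fin (n+1) := ⟨t, Nat.lt_succ_of_le ht⟩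

variable {X Y : Fin (n+1) → Type*} [∀ i, MeasurableSpace (X i)] [∀ i, MeasurableSpace (Y i)]
  [∀ i, StandardBorelSpace (X i)] [∀ i, StandardBorelSpace (Y i)]
  [∀ i, Nonempty (X i)] [∀ i, Nonempty (Y i)]

/-- The marginal `p^{Y_{[t]}}` of `p` on the observations up to time `t`. -/
noncomputable def obsMarginal (p : Measure (∀ i, X i × Y i)) (t : ℕ) (ht : t ≤ n) :
    Measure (∀ i : Fin (t+1), Y (emb ht i)) :=
  p.map (fun ω i => (ω (emb ht i)).2)

/-- The marginal `p^{Y_{[t]}, X_t}` of `p` on the observations up to time `t` together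
with the hidden state at time `t`. -/
noncomputable def obsStateMarginal (p : Measure (∀ i, X i × Y i)) (t : ℕ) (ht : t ≤ n) :
    Measure ((∀ i : Fin (t+1), Y (emb ht i)) × X (idx ht)) :=
  p.map (fun ω => (fun i => (ω (emb ht i)).2, (ω (idx ht)).1))

instance obsStateMarginal_isFiniteMeasure (p : Measure (∀ i, X i × Y i))
    [IsFiniteMeasure p] (t : ℕ) (ht : t ≤ n) :
    IsFiniteMeasure (obsStateMarginal p t ht) := by
  unfold obsStateMarginal; infer_instance

/-- The Bayes filter `B_t`: the disintegration kernel of the marginal of `p` on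
`(∏_{i=0}^t Y_i) × X_t`. -/
noncomputable def bayesFilter (p : Measure (∀ i, X i × Y i)) [IsFiniteMeasure p]
    (t : ℕ) (ht : t ≤ n) :
    Kernel (∀ i : Fin (t+1), Y (emb ht i)) (X (idx ht)) :=
  (obsStateMarginal p t ht).condKernel

instance bayesFilter_isMarkovKernel (p : Measure (∀ i, X i × Y i)) [IsFiniteMeasure p]
    (t : ℕ) (ht : t ≤ n) : IsMarkovKernel (bayesFilter (X := X) p t ht) := by
  unfold bayesFilter; infer_instance

/-- The index `t + 1 + i` of a future observation, as an element of `Fin (n+1)`. -/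
def femb {t : ℕ} (ht : t ≤ n) (i : Fin (n - t)) : Fin (n+1) :=
  ⟨t + 1 + i.1, by have := i.isLt; omega⟩

/-- Backward value function: `futObs f g T t x` is the probability that the future
observations `y_{t+1}, …, y_n`, generated from the hidden state `X_t = x` by iterating
the kernels `f_{t+1}, g_{t+1}, …, f_n, g_n`, lie in the sets `T_{t+1}, …, T_n`. -/
noncomputable def futObs (f : ∀ t : Fin n, Kernel (X t.castSucc) (X t.succ))
    (g : ∀ t : Fin (n+1), Kernel (X t) (Y t)) (T : ∀ i, Set (Y i)) :
    ∀ t : Fin (n+1), X t → ℝ≥0∞ :=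
  Fin.reverseInduction (fun _ => 1)
    (fun i ih x => ∫⁻ x', (g i.succ x' (T i.succ)) * ih x' ∂ (f i x))

/-- The marginal `p^{Y_{[n]}, X_t}` of `p` on all the observations together with the
hidden state at time `t`. -/
noncomputable def obsAllStateMarginal (p : Measure (∀ i, X i × Y i)) (t : ℕ) (ht : t ≤ n) :
    Measure ((∀ i, Y i) × X (idx ht)) :=
  p.map (fun ω => (fun i => (ω i).2, (ω (idx ht)).1))

instance obsAllStateMarginal_isFiniteMeasure (p : Measure (∀ i, X i × Y i))
    [IsFiniteMeasure p] (t : ℕ) (ht : t ≤ n) :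
    IsFiniteMeasure (obsAllStateMarginal p t ht) := by
  unfold obsAllStateMarginal; infer_instance

/-- The Bayes smoother `ξ_t`: the disintegration kernel of the marginal of `p` on
`(∏_{i=0}^n Y_i) × X_t`. -/
noncomputable def bayesSmoother (p : Measure (∀ i, X i × Y i)) [IsFiniteMeasure p]
    (t : ℕ) (ht : t ≤ n) : Kernel (∀ i, Y i) (X (idx ht)) :=
  (obsAllStateMarginal p t ht).condKernel

section Backward

variable {X Y : Fin (n+1) → Type*} [∀ i, MeasurableSpace (X i)] [∀ i, MeasurableSpace (Y i)]
  {f : ∀ t : Fin n, Kernel (X t.castSucc) (X t.succ)}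
  {g : ∀ t : Fin (n+1), Kernel (X t) (Y t)} {S : ∀ i, Set (X i)} {T : ∀ i, Set (Y i)}

lemma hmmBack_last (x : X (Fin.last n)) :
    hmmBack f g S T (Fin.last n) x = g (Fin.last n) x (T (Fin.last n)) := by
  simp [hmmBack]

lemma hmmBack_castSucc (i : Fin n) (x : X i.castSucc) :
    hmmBack f g S T i.castSucc x =
      g i.castSucc x (T i.castSucc) * ∫⁻ x' in S i.succ, hmmBack f g S T i.succ x' ∂(f i x) := by
  simp [hmmBack]

lemma futObs_last (x : X (Fin.last n)) : futObs f g T (Fin.last n) x = 1 := by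
  simp [futObs]

lemma futObs_castSucc (i : Fin n) (x : X i.castSucc) :
    futObs f g T i.castSucc x =
      ∫⁻ x', g i.succ x' (T i.succ) * futObs f g T i.succ x' ∂(f i x) := by
  simp [futObs]

lemma measurable_hmmBack [∀ t, IsMarkovKernel (f t)] (hS : ∀ i, MeasurableSet (S i))
    (hT : ∀ i, MeasurableSet (T i)) (s : Fin (n+1)) : Measurable (hmmBack f g S T s) := by
  induction s using Fin.reverseInduction with
  | last =>
    simp_rw [funext hmmBack_last]
    exact Kernel.measurable_coe _ (hT _)
  | cast i ih =>
    rw [funext (hmmBack_castSucc i)]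
    exact (Kernel.measurable_coe _ (hT _)).mul (ih.setLIntegral_kernel (hS _))

lemma hmmBack_eq_mul_futObs (s : Fin (n+1)) (hS : ∀ i, s < i → S i = Set.univ) (x : X s) :
    hmmBack f g S T s x = g s x (T s) * futObs f g T s x := by
  induction s using Fin.reverseInduction with
  | last => rw [hmmBack_last, futObs_last, mul_one]
  | cast i ih =>
    rw [hmmBack_castSucc, futObs_castSucc, hS _ i.castSucc_lt_succ, setLIntegral_univ]
    congr 1
    exact lintegral_congr fun x' => ih (fun j hj => hS j (i.castSucc_lt_succ.trans hj)) x'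

lemma futObs_eq_one [∀ t, IsMarkovKernel (f t)] [∀ t, IsMarkovKernel (g t)]
    (s : Fin (n+1)) (hT : ∀ i, s < i → T i = Set.univ) (x : X s) :
    futObs f g T s x = 1 := by
  induction s using Fin.reverseInduction with
  | last => exact futObs_last x
  | cast i ih =>
    rw [futObs_castSucc, hT _ i.castSucc_lt_succ]
    simp [ih (fun j hj => hT j (i.castSucc_lt_succ.trans hj))]

end Backward

section Forward

variable {X Y : Fin (n+1) → Type*} [∀ i, MeasurableSpace (X i)] [∀ i, MeasurableSpace (Y i)]

/-- The unnormalized law of the hidden state at time `s` restricted to the event that the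
observations strictly before time `s` lie in the sets `T i`. -/
noncomputable def forwardMeasure (f₀ : Measure (X 0))
    (f : ∀ t : Fin n, Kernel (X t.castSucc) (X t.succ))
    (g : ∀ t : Fin (n+1), Kernel (X t) (Y t)) (T : ∀ i, Set (Y i)) :
    ∀ s : Fin (n+1), Measure (X s) :=
  Fin.induction f₀ fun i ν => (ν.withDensity fun x => g i.castSucc x (T i.castSucc)).bind (f i)

variable {f₀ : Measure (X 0)} {f : ∀ t : Fin n, Kernel (X t.castSucc) (X t.succ)}
  {g : ∀ t : Fin (n+1), Kernel (X t) (Y t)} {S : ∀ i, Set (X i)} {T T' : ∀ i, Set (Y i)}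
  {p : Measure (∀ i, X i × Y i)}

lemma forwardMeasure_zero : forwardMeasure f₀ f g T 0 = f₀ := by
  simp [forwardMeasure]

lemma forwardMeasure_succ (i : Fin n) :
    forwardMeasure f₀ f g T i.succ =
      ((forwardMeasure f₀ f g T i.castSucc).withDensity
        fun x => g i.castSucc x (T i.castSucc)).bind (f i) := by
  simp [forwardMeasure]

lemma forwardMeasure_congr (s : Fin (n+1)) (h : ∀ i < s, T i = T' i) :
    forwardMeasure f₀ f g T s = forwardMeasure f₀ f g T' s := by
  induction s using Fin.induction with
  | zero => rw [forwardMeasure_zero, forwardMeasure_zero]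
  | succ i ih =>
    rw [forwardMeasure_succ, forwardMeasure_succ, h _ i.castSucc_lt_succ,
      ih fun j hj => h j (hj.trans i.castSucc_lt_succ)]

lemma IsHMM.rect_eq_setLIntegral_hmmBack [∀ t, IsMarkovKernel (f t)] (hp : IsHMM p f₀ f g)
    (hS : ∀ i, MeasurableSet (S i)) (hT : ∀ i, MeasurableSet (T i))
    (s : Fin (n+1)) (hSs : ∀ i < s, S i = Set.univ) :
    p (Set.univ.pi fun i => S i ×ˢ T i) =
      ∫⁻ x in S s, hmmBack f g S T s x ∂(forwardMeasure f₀ f g T s) := by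
  induction s using Fin.induction with
  | zero => exact hp S T hS hT
  | succ i ih =>
    have hg : Measurable fun x => g i.castSucc x (T i.castSucc) :=
      Kernel.measurable_coe _ (hT _)
    have hm := measurable_hmmBack (f := f) (g := g) hS hT i.succ
    rw [ih fun j hj => hSs j (hj.trans i.castSucc_lt_succ), hSs _ i.castSucc_lt_succ,
      setLIntegral_univ, forwardMeasure_succ, ← lintegral_indicator (hS _),
      Measure.lintegral_bind (f i).measurable.aemeasurable (hm.indicator (hS _)).aemeasurable]
    simp_rw [lintegral_indicator (hS _), hmmBack_castSucc]
    rw [lintegral_withDensity_eq_lintegral_mul _ hg (hm.setLIntegral_kernel (hS _))]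
    rfl

lemma IsHMM.obs_state_rect [∀ t, IsMarkovKernel (f t)] (hp : IsHMM p f₀ f g)
    (hT : ∀ i, MeasurableSet (T i)) (s : Fin (n+1)) {A : Set (X s)} (hA : MeasurableSet A) :
    p {ω | (∀ i, (ω i).2 ∈ T i) ∧ (ω s).1 ∈ A} =
      ∫⁻ x in A, g s x (T s) * futObs f g T s x ∂(forwardMeasure f₀ f g T s) := by
  have hne (i) (hi : i ≠ s) : Function.update (fun i => (Set.univ : Set (X i))) s A i = Set.univ :=
    Function.update_of_ne hi _ _
  have hS (i) : MeasurableSet (Function.update (fun i => (Set.univ : Set (X i))) s A i) := by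
    by_cases hi : i = s
    · subst hi; simpa using hA
    · rw [hne i hi]; exact MeasurableSet.univ
  have h := hp.rect_eq_setLIntegral_hmmBack hS hT s fun i hi => hne i hi.ne
  simp_rw [hmmBack_eq_mul_futObs s (fun i hi => hne i hi.ne'), Function.update_self] at h
  rw [← h]
  congr 1
  ext ω
  simp only [Set.mem_ofPred_eq, Set.mem_pi, Set.mem_univ, true_imp_iff, Set.mem_prod]
  constructor
  · rintro ⟨h₁, h₂⟩ i
    refine ⟨?_, h₁ i⟩
    by_cases hi : i = s
    · subst hi; simpa using h₂
    · rw [hne i hi]; trivial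
  · intro h
    exact ⟨fun i => (h i).2, by simpa using (h s).1⟩

end Forward

section Split

variable {t : ℕ}

lemma eq_femb_sub (ht : t ≤ n) {i : Fin (n+1)} (hi : ¬ i.1 ≤ t) :
    femb ht ⟨i.1 - (t + 1), by omega⟩ = i :=
  Fin.ext (by simp only [femb]; omega)

lemma femb_injective (ht : t ≤ n) : Function.Injective (femb ht) := fun i j h => by
  have := congrArg Fin.val h
  simp only [femb] at this
  exact Fin.ext (by omega)

lemma forall_fin_iff_emb_femb (ht : t ≤ n) {P : Fin (n+1) → Prop} :
    (∀ i, P i) ↔ (∀ i, P (emb ht i)) ∧ ∀ i, P (femb ht i) := by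
  refine ⟨fun h => ⟨fun i => h _, fun i => h _⟩, fun h i => ?_⟩
  by_cases hi : i.1 ≤ t
  · exact h.1 ⟨i.1, Nat.lt_succ_of_le hi⟩
  · exact eq_femb_sub ht hi ▸ h.2 _

/-- Concatenation of a family indexed by the times up to `t` with a family indexed by the
times after `t`. -/
def concat {Z : Fin (n+1) → Type*} (ht : t ≤ n) (a : ∀ i, Z (emb ht i)) (b : ∀ i, Z (femb ht i))
    (i : Fin (n+1)) : Z i :=
  if hi : i.1 ≤ t then a ⟨i.1, Nat.lt_succ_of_le hi⟩
  else eq_femb_sub ht hi ▸ b ⟨i.1 - (t + 1), by omega⟩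

lemma concat_emb {Z : Fin (n+1) → Type*} (ht : t ≤ n) (a : ∀ i, Z (emb ht i))
    (b : ∀ i, Z (femb ht i)) (i : Fin (t+1)) : concat ht a b (emb ht i) = a i :=
  dif_pos (Nat.le_of_lt_succ i.2)

lemma concat_femb {Z : Fin (n+1) → Type*} (ht : t ≤ n) (a : ∀ i, Z (emb ht i))
    (b : ∀ i, Z (femb ht i)) (i : Fin (n-t)) : concat ht a b (femb ht i) = b i := by
  have h (j : Fin (n-t)) (hj : femb ht j = femb ht i) : hj ▸ b j = b i := by
    obtain rfl := femb_injective ht hj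
    rfl
  exact (dif_neg (by simp only [femb]; omega)).trans (h _ _)

lemma concat_restrict {Z : Fin (n+1) → Type*} (ht : t ≤ n) (z : ∀ i, Z i) :
    concat ht (fun i => z (emb ht i)) (fun i => z (femb ht i)) = z :=
  funext <| (forall_fin_iff_emb_femb ht).2
    ⟨concat_emb (Z := Z) ht _ _, concat_femb (Z := Z) ht _ _⟩

lemma measurable_concat {Z : Fin (n+1) → Type*} [∀ i, MeasurableSpace (Z i)] (ht : t ≤ n) :
    Measurable fun q : (∀ i, Z (emb ht i)) × (∀ i, Z (femb ht i)) => concat ht q.1 q.2 := by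
  refine measurable_pi_iff.2 <| (forall_fin_iff_emb_femb ht).2 ⟨fun i => ?_, fun i => ?_⟩
  · simp_rw [concat_emb]; fun_prop
  · simp_rw [concat_femb]; fun_prop

end Split

section JointLaw

lemma measure_ext_pi_prod_pi {ι κ : Type*} [Finite ι] [Finite κ] {A : ι → Type*} {B : κ → Type*}
    {γ : Type*} [∀ i, MeasurableSpace (A i)] [∀ i, MeasurableSpace (B i)] [MeasurableSpace γ]
    {μ ν : Measure ((∀ i, A i) × γ × (∀ i, B i))} [IsFiniteMeasure μ]
    (h : ∀ (a : ∀ i, Set (A i)) (s : Set γ) (b : ∀ i, Set (B i)), (∀ i, MeasurableSet (a i)) →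
      MeasurableSet s → (∀ i, MeasurableSet (b i)) →
      μ (Set.univ.pi a ×ˢ s ×ˢ Set.univ.pi b) = ν (Set.univ.pi a ×ˢ s ×ˢ Set.univ.pi b)) :
    μ = ν := by
  have spanA := IsCountablySpanning.pi fun i => isCountablySpanning_measurableSet (α := A i)
  have spanB := IsCountablySpanning.pi fun i => isCountablySpanning_measurableSet (α := B i)
  have spanG := isCountablySpanning_measurableSet (α := γ)
  refine ext_of_generate_finite _
    (generateFrom_eq_prod generateFrom_pi
      (generateFrom_eq_prod MeasurableSpace.generateFrom_measurableSet generateFrom_pi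
        spanG spanB) spanA (spanG.prod spanB)).symm
    (isPiSystem_pi.prod (MeasurableSpace.isPiSystem_measurableSet.prod isPiSystem_pi)) ?_ ?_
  · rintro _ ⟨_, ⟨a, ha, rfl⟩, _, ⟨s, hs, _, ⟨b, hb, rfl⟩, rfl⟩, rfl⟩
    exact h a s b (fun i => ha i trivial) hs (fun i => hb i trivial)
  · simpa using h (fun _ => Set.univ) Set.univ (fun _ => Set.univ) (fun _ => .univ) .univ
      (fun _ => .univ)

variable {X Y : Fin (n+1) → Type*} [∀ i, MeasurableSpace (X i)] [∀ i, MeasurableSpace (Y i)]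
  {f₀ : Measure (X 0)} {f : ∀ t : Fin n, Kernel (X t.castSucc) (X t.succ)}
  {g : ∀ t : Fin (n+1), Kernel (X t) (Y t)} [∀ t, IsMarkovKernel (f t)]
  [∀ t, IsMarkovKernel (g t)] {p : Measure (∀ i, X i × Y i)} {t : ℕ} {T : ∀ i, Set (Y i)}

lemma IsHMM.obsStateMarginal_rect (hp : IsHMM p f₀ f g) (ht : t ≤ n)
    (hT : ∀ i, MeasurableSet (T i)) {A : Set (X (idx ht))} (hA : MeasurableSet A) :
    obsStateMarginal p t ht ((Set.univ.pi fun i => T (emb ht i)) ×ˢ A) =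
      ∫⁻ x in A, g (idx ht) x (T (idx ht)) ∂(forwardMeasure f₀ f g T (idx ht)) := by
  let T' : ∀ i, Set (Y i) :=
    concat (Z := fun i => Set (Y i)) ht (fun i => T (emb ht i)) fun _ => Set.univ
  have hT'le (i : Fin (n+1)) (hi : i ≤ idx ht) : T' i = T i :=
    concat_emb (Z := fun i => Set (Y i)) ht _ _ ⟨i.1, Nat.lt_succ_of_le hi⟩
  have hT'femb (i) : T' (femb ht i) = Set.univ :=
    concat_femb (Z := fun i => Set (Y i)) ht _ _ i
  have hT'emb (i) : T' (emb ht i) = T (emb ht i) :=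
    concat_emb (Z := fun i => Set (Y i)) ht _ _ i
  have hT'lt (i : Fin (n+1)) (hi : idx ht < i) : T' i = Set.univ := by
    have := hT'femb ⟨i.1 - (t + 1), by have : t < i.1 := hi; omega⟩
    rwa [eq_femb_sub ht (not_le.2 hi)] at this
  have hT' : ∀ i, MeasurableSet (T' i) := (forall_fin_iff_emb_femb ht).2
    ⟨fun i => hT'emb i ▸ hT _, fun i => hT'femb i ▸ .univ⟩
  have h := hp.obs_state_rect hT' (idx ht) hA
  simp_rw [futObs_eq_one (f := f) (g := g) (idx ht) hT'lt, mul_one, hT'le _ le_rfl,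
    forwardMeasure_congr (f₀ := f₀) (f := f) (g := g) (idx ht) fun i hi => hT'le i hi.le] at h
  rw [← h, obsStateMarginal, Measure.map_apply (by fun_prop)
    ((MeasurableSet.univ_pi fun i => hT _).prod hA)]
  congr 1
  ext ω
  simp [forall_fin_iff_emb_femb ht, hT'emb, hT'femb]

lemma IsHMM.setLIntegral_obsStateMarginal (hp : IsHMM p f₀ f g) (ht : t ≤ n)
    (hT : ∀ i, MeasurableSet (T i)) {A : Set (X (idx ht))} (hA : MeasurableSet A)
    {h : X (idx ht) → ℝ≥0∞} (hh : Measurable h) :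
    ∫⁻ q in (Set.univ.pi fun i => T (emb ht i)) ×ˢ A, h q.2 ∂(obsStateMarginal p t ht) =
      ∫⁻ x in A, g (idx ht) x (T (idx ht)) * h x ∂(forwardMeasure f₀ f g T (idx ht)) := by
  have hg : Measurable fun x => g (idx ht) x (T (idx ht)) := Kernel.measurable_coe _ (hT _)
  have hR : MeasurableSet (Set.univ.pi fun i => T (emb ht i)) := .univ_pi fun i => hT _
  have key : ((obsStateMarginal p t ht).restrict
        ((Set.univ.pi fun i => T (emb ht i)) ×ˢ Set.univ)).map Prod.snd =
      (forwardMeasure f₀ f g T (idx ht)).withDensity fun x => g (idx ht) x (T (idx ht)) := by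
    ext B hB
    rw [Measure.map_apply measurable_snd hB, Measure.restrict_apply (measurable_snd hB),
      withDensity_apply _ hB, ← hp.obsStateMarginal_rect ht hT hB]
    congr 1
    ext q
    simp [and_comm]
  have hset : (Set.univ.pi fun i => T (emb ht i)) ×ˢ A =
      Prod.snd ⁻¹' A ∩ (Set.univ.pi fun i => T (emb ht i)) ×ˢ Set.univ := by
    ext q
    simp [and_comm]
  rw [hset, ← Measure.restrict_restrict (measurable_snd hA),
    ← setLIntegral_map hA hh measurable_snd, key, restrict_withDensity hA,
    lintegral_withDensity_eq_lintegral_mul _ hg hh]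
  rfl

lemma IsHMM.map_past_state_future [IsFiniteMeasure p] (hp : IsHMM p f₀ f g) (ht : t ≤ n)
    (β : Kernel (X (idx ht)) (∀ i : Fin (n - t), Y (femb ht i))) [IsMarkovKernel β]
    (hβ : ∀ (T : ∀ i, Set (Y i)), (∀ i, MeasurableSet (T i)) → ∀ x,
      β x (Set.univ.pi fun i => T (femb ht i)) = futObs f g T (idx ht) x) :
    p.map (fun ω => ((fun i : Fin (t+1) => (ω (emb ht i)).2), (ω (idx ht)).1,
        (fun i : Fin (n-t) => (ω (femb ht i)).2))) =
      (obsStateMarginal p t ht ⊗ₘ Kernel.prodMkLeft _ β).map MeasurableEquiv.prodAssoc := by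
  refine measure_ext_pi_prod_pi fun a s b ha hs hb => ?_
  obtain ⟨T, rfl, rfl⟩ : ∃ T : ∀ i, Set (Y i),
      (fun i => T (emb ht i)) = a ∧ (fun i => T (femb ht i)) = b :=
    ⟨concat (Z := fun i => Set (Y i)) ht a b,
      funext (concat_emb (Z := fun i => Set (Y i)) ht a b),
      funext (concat_femb (Z := fun i => Set (Y i)) ht a b)⟩
  have hT : ∀ i, MeasurableSet (T i) := (forall_fin_iff_emb_femb ht).2 ⟨ha, hb⟩
  have ha' : MeasurableSet (Set.univ.pi fun i => T (emb ht i)) := .univ_pi ha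
  have hb' : MeasurableSet (Set.univ.pi fun i => T (femb ht i)) := .univ_pi hb
  have hpre : MeasurableEquiv.prodAssoc ⁻¹' ((Set.univ.pi fun i => T (emb ht i)) ×ˢ s ×ˢ
      Set.univ.pi fun i => T (femb ht i)) =
      ((Set.univ.pi fun i => T (emb ht i)) ×ˢ s) ×ˢ Set.univ.pi fun i => T (femb ht i) := by
    ext q
    simp [MeasurableEquiv.prodAssoc, and_assoc]
  rw [Measure.map_apply (by fun_prop) (ha'.prod (hs.prod hb')),
    Measure.map_apply (by fun_prop) (ha'.prod (hs.prod hb')), hpre,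
    Measure.compProd_apply_prod (ha'.prod hs) hb']
  simp_rw [Kernel.prodMkLeft_apply]
  rw [hp.setLIntegral_obsStateMarginal ht hT hs (Kernel.measurable_coe β hb')]
  simp_rw [hβ T hT]
  rw [← hp.obs_state_rect hT (idx ht) hs]
  congr 1
  ext ω
  simp only [Set.mem_preimage, Set.mem_prod, Set.mem_pi, Set.mem_univ, true_imp_iff,
    Set.mem_ofPred_eq, forall_fin_iff_emb_femb ht]
  tauto

end JointLaw

section CompProd

variable {α α' γ δ : Type*} [MeasurableSpace α] [MeasurableSpace α'] [MeasurableSpace γ]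
  [MeasurableSpace δ]

lemma map_compProd_comap {μ : Measure α} [SFinite μ] {η : Kernel α' γ} [IsSFiniteKernel η]
    {φ : α → α'} (hφ : Measurable φ) :
    (μ ⊗ₘ η.comap φ hφ).map (Prod.map φ id) = μ.map φ ⊗ₘ η := by
  ext s hs
  rw [Measure.map_apply (by fun_prop) hs, Measure.compProd_apply (hs.preimage (by fun_prop)),
    Measure.compProd_apply hs, lintegral_map (Kernel.measurable_kernel_prodMk_left hs) hφ]
  rfl

lemma compProd_comap_eq_map {μ : Measure α} [SFinite μ] {η : Kernel α' γ} [IsSFiniteKernel η]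
    {φ : α → α'} (hφ : Measurable φ) {ψ : α' → α} (hψ : Measurable ψ)
    (hψφ : Function.LeftInverse ψ φ) :
    μ ⊗ₘ η.comap φ hφ = (μ.map φ ⊗ₘ η).map (Prod.map ψ id) := by
  rw [← map_compProd_comap hφ, Measure.map_map (by fun_prop) (by fun_prop), Prod.map_comp_map,
    hψφ.comp_eq_id, Function.id_comp, Prod.map_id, Measure.map_id]

lemma compProd_swapRight_compProd_prodMkLeft {μ : Measure α} [SFinite μ] {η : Kernel α γ}
    [IsSFiniteKernel η] {β : Kernel γ δ} [IsSFiniteKernel β] :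
    μ ⊗ₘ Kernel.swapRight (η ⊗ₖ Kernel.prodMkLeft α β) =
      ((μ ⊗ₘ η) ⊗ₘ Kernel.prodMkLeft α β).map fun q => (q.1.1, q.2, q.1.2) := by
  rw [Kernel.swapRight_eq, Measure.compProd_map measurable_swap, ← Measure.compProd_assoc,
    Measure.map_map (by fun_prop) (by fun_prop)]
  rfl

/-- If the conditional law of `(b, c)` given `a` is `κ`, then the conditional law of `c` given
`(a, b)` is `κ.condKernel`. -/
lemma map_prodAssoc_symm_compProd_eq [MeasurableSpace.CountableOrCountablyGenerated α γ]
    [StandardBorelSpace δ] [Nonempty δ] {μ : Measure α} [SFinite μ] {κ : Kernel α (γ × δ)}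
    [IsFiniteKernel κ] :
    (μ ⊗ₘ κ).map MeasurableEquiv.prodAssoc.symm = (μ ⊗ₘ Kernel.fst κ) ⊗ₘ κ.condKernel := by
  rw [← Measure.compProd_assoc, κ.disintegrate κ.condKernel]

end CompProd


/-- **Smoothing as conditioning the filter output on the future observations** in
`BorelStoch`: if `β_t` is the Markov kernel sending a hidden state `x` at time `t` to the
law of the future observations generated from it, then the Bayes smoother `ξ_t` agrees,
almost everywhere with respect to the observation marginal `p^{Y_{[n]}}`, with the
conditional of the kernel `κ : y ↦ swap ((B_t y) ⊗ₘ β_t)`. -/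
theorem bayesSmoother_eq_condKernel
    (f₀ : Measure (X 0)) [IsProbabilityMeasure f₀]
    (f : ∀ t : Fin n, Kernel (X t.castSucc) (X t.succ))
    (g : ∀ t : Fin (n+1), Kernel (X t) (Y t))
    [∀ t, IsMarkovKernel (f t)] [∀ t, IsMarkovKernel (g t)]
    (p : Measure (∀ i, X i × Y i)) [IsProbabilityMeasure p]
    (hp : IsHMM p f₀ f g) (t : ℕ) (ht : t ≤ n)
    (β : Kernel (X (idx ht)) (∀ i : Fin (n - t), Y (femb ht i))) [IsMarkovKernel β]
    (hβ : ∀ (T : ∀ i, Set (Y i)), (∀ i, MeasurableSet (T i)) → ∀ x,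
      β x (Set.univ.pi fun i => T (femb ht i)) = futObs f g T (idx ht) x) :
    ∀ᵐ y ∂ (p.map (fun ω i => (ω i).2) : Measure (∀ i, Y i)),
      bayesSmoother p t ht y =
        Kernel.condKernel
          (Kernel.swapRight ((bayesFilter p t ht) ⊗ₖ Kernel.prodMkLeft _ β))
          (fun i : Fin (t+1) => y (emb ht i), fun i : Fin (n - t) => y (femb ht i)) := by
  let past : (∀ i, Y i) → (∀ i : Fin (t+1), Y (emb ht i)) := fun y i => y (emb ht i)
  let future : (∀ i, Y i) → (∀ i : Fin (n - t), Y (femb ht i)) := fun y i => y (femb ht i)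
  let ρ := obsAllStateMarginal p t ht
  set κ := Kernel.swapRight (bayesFilter p t ht ⊗ₖ Kernel.prodMkLeft _ β) with hκ
  have hφ : Measurable fun y => (past y, future y) := by fun_prop
  have hρfst : ρ.fst = p.map (fun ω i => (ω i).2) := Measure.fst_map_prodMk (by fun_prop)
  have hjoint : ρ.map (Prod.map (fun y => (past y, future y)) id) =
      ((obsStateMarginal p t ht).fst ⊗ₘ κ).map MeasurableEquiv.prodAssoc.symm := by
    have h := congrArg (Measure.map fun q => ((q.1, q.2.2), q.2.1))
      (hp.map_past_state_future ht β hβ)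
    rw [Measure.map_map (by fun_prop) (by fun_prop),
      Measure.map_map (by fun_prop) (by fun_prop)] at h
    rw [hκ, compProd_swapRight_compProd_prodMkLeft, bayesFilter, Measure.disintegrate,
      Measure.map_map (by fun_prop) (by fun_prop)]
    refine Eq.trans ?_ h
    exact Measure.map_map (by fun_prop) (by fun_prop)
  rw [map_prodAssoc_symm_compProd_eq] at hjoint
  have hmarg : ρ.fst.map (fun y => (past y, future y)) =
      (obsStateMarginal p t ht).fst ⊗ₘ Kernel.fst κ := by
    have h := congrArg Measure.fst hjoint
    rw [Measure.fst_compProd] at h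
    rw [← h, Measure.fst, Measure.fst, Measure.map_map (by fun_prop) (by fun_prop),
      Measure.map_map (by fun_prop) (by fun_prop)]
    rfl
  have hρ : ρ = ρ.fst ⊗ₘ κ.condKernel.comap _ hφ := by
    rw [compProd_comap_eq_map hφ (measurable_concat ht) (concat_restrict ht), hmarg, ← hjoint,
      Measure.map_map ((measurable_concat ht).prodMap measurable_id) (by fun_prop),
      Prod.map_comp_map]
    have : (fun q : (∀ i, Y (emb ht i)) × (∀ i, Y (femb ht i)) => concat ht q.1 q.2) ∘
        (fun y => (past y, future y)) = id := funext (concat_restrict ht)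
    rw [this, Function.id_comp, Prod.map_id, Measure.map_id]
  rw [← hρfst]
  filter_upwards [eq_condKernel_of_measure_eq_compProd _ hρ] with y hy
  exact hy.symm

end BorelHMM
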